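/- Let (A, [·,·], ∧) be a Gerstenhaber algebra, E the graded vector space with E_{−k} := A^k, l_2(P_1,P_2) := (−1)^{|P_1|}[P_1,P_2], and l_i := ι_{l_2}𝒩_{i−1} for i > 2, where 𝒩_k(P_1,…,P_k) := P_1∧⋯∧P_k. Then for all positive integers m, n: [l_m, l_n]_RN = 0. -/

import Mathlib

open Finset

section Framework

variable {V : Type*} [AddCommGroup V] [Module ℝ V]

/-- The Koszul sign `ε(σ)` of a permutation `σ` acting on homogeneous elements whose
degrees are given by `d`. -/
def koszulSign {n : ℕ} (d : Fin n → ℤ) (σ : Equiv.Perm (Fin n)) : ℤ :=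
  ∏ p ∈ Finset.univ.filter (fun p : Fin n × Fin n => p.1 < p.2 ∧ σ p.2 < σ p.1),
    (-1 : ℤ) ^ (d (σ p.1) * d (σ p.2)).natAbs

/-- The `(k, n-k)`-unshuffles: permutations of `Fin n` which are increasing on the
first `k` indices and on the remaining ones. -/
def unshuffles (k n : ℕ) : Finset (Equiv.Perm (Fin n)) :=
  Finset.univ.filter (fun σ =>
    (∀ i j : Fin n, i < j → (j : ℕ) < k → σ i < σ j) ∧
    (∀ i j : Fin n, i < j → k ≤ (i : ℕ) → σ i < σ j))

/-- A (raw) vector valued `k`-form on the graded vector space with grading `𝒢`: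
it assigns, to homogeneous elements of degrees `d 0, …, d (k-1)`, an element of `V`. -/
abbrev GForm (𝒢 : ℤ → Submodule ℝ V) (k : ℕ) : Type _ :=
  (d : Fin k → ℤ) → ((i : Fin k) → 𝒢 (d i)) → V

/-- Transport of a vector valued form along an equality of arities. -/
def castForm {𝒢 : ℤ → Submodule ℝ V} {m n : ℕ} (h : m = n) (K : GForm 𝒢 m) : GForm 𝒢 n :=
  h ▸ K

variable (𝒢 : ℤ → Submodule ℝ V)

/-- Projection on the homogeneous component of degree `i`. -/
def prj [DirectSum.Decomposition 𝒢] (i : ℤ) (v : V) : 𝒢 i :=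
  DirectSum.decompose 𝒢 v i

/-- Insertion of a `k`-form `K` of degree `δK` into an `(l+1)`-form `L`:
`ι_K L (X_1,…,X_{k+l}) = Σ_{σ ∈ Sh(k,l)} ε(σ) L(K(X_{σ(1)},…,X_{σ(k)}), X_{σ(k+1)},…)`. -/
def insertPos [DirectSum.Decomposition 𝒢] {k l : ℕ} (δK : ℤ) (K : GForm 𝒢 k)
    (L : GForm 𝒢 (l + 1)) : GForm 𝒢 (k + l) := fun d x =>
  ∑ σ ∈ unshuffles k (k + l),
    koszulSign d σ •
      L (Fin.cons ((∑ i : Fin k, d (σ (Fin.castAdd l i))) + δK)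
          (fun j : Fin l => d (σ (Fin.natAdd k j))))
        (Fin.cons
          (prj 𝒢 ((∑ i : Fin k, d (σ (Fin.castAdd l i))) + δK)
            (K (fun i => d (σ (Fin.castAdd l i))) (fun i => x (σ (Fin.castAdd l i)))))
          (fun j : Fin l => x (σ (Fin.natAdd k j))))

/-- Insertion operator `ι_K L` of a `k`-form of degree `δK` into an `l`-form. -/
def insertionOp [DirectSum.Decomposition 𝒢] {k l : ℕ} (δK : ℤ) (K : GForm 𝒢 k) :
    GForm 𝒢 l → GForm 𝒢 (k + l - 1) :=
  match l with
  | 0 => fun _ => fun _ _ => 0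
  | _ + 1 => fun L => insertPos 𝒢 δK K L

/-- A formal sum of vector valued forms of all arities. -/
abbrev MultiForm : Type _ := (k : ℕ) → GForm 𝒢 k

/-- A single `k`-form seen as a formal sum concentrated in arity `k`. -/
def singleF (k : ℕ) (K : GForm 𝒢 k) : MultiForm 𝒢 :=
  fun n => if h : n = k then castForm h.symm K else 0

/-- The Richardson–Nijenhuis bracket `[K,L] = ι_K L - (-1)^{K̄ L̄} ι_L K` of formal
sums of forms `K` (of degree `δK`) and `L` (of degree `δL`), computed aritywise. -/
def rnBracketM [DirectSum.Decomposition 𝒢] (δK δL : ℤ) (K L : MultiForm 𝒢) : MultiForm 𝒢 :=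
  fun n =>
    (∑ p ∈ (Finset.range (n + 2)).attach,
      castForm (by have := Finset.mem_range.mp p.2; omega)
        (insertionOp 𝒢 δK (K p.1) (L (n + 1 - p.1))))
    - ((-1 : ℤ) ^ (δK * δL).natAbs) •
      (∑ p ∈ (Finset.range (n + 2)).attach,
        castForm (by have := Finset.mem_range.mp p.2; omega)
          (insertionOp 𝒢 δL (L p.1) (K (n + 1 - p.1))))

/-- `K` is a graded symmetric vector valued `k`-form of degree `δ`. -/
structure IsSymFormOfDeg {k : ℕ} (δ : ℤ) (K : GForm 𝒢 k) : Prop where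
  mem_grading : ∀ (d : Fin k → ℤ) (x : (i : Fin k) → 𝒢 (d i)), K d x ∈ 𝒢 ((∑ i, d i) + δ)
  map_add : ∀ (d : Fin k → ℤ) (x : (i : Fin k) → 𝒢 (d i)) (i : Fin k) (a b : 𝒢 (d i)),
    K d (Function.update x i (a + b)) = K d (Function.update x i a) + K d (Function.update x i b)
  map_smul : ∀ (d : Fin k → ℤ) (x : (i : Fin k) → 𝒢 (d i)) (i : Fin k) (c : ℝ) (a : 𝒢 (d i)),
    K d (Function.update x i (c • a)) = c • K d (Function.update x i a)
  symm : ∀ (d : Fin k → ℤ) (σ : Equiv.Perm (Fin k)) (x : (i : Fin k) → 𝒢 (d i)),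
    K (d ∘ σ) (fun i => x (σ i)) = koszulSign d σ • K d x

/-- The `L_∞` identities for a family `(l_i)` of symmetric vector valued forms of degree 1:
for each `n`, `Σ_{i+j=n+1} Σ_{σ ∈ Sh(i,j-1)} ε(σ) l_j (l_i (X_σ(1),…), X_…) = 0`. -/
def LInftyIdentity [DirectSum.Decomposition 𝒢] (l : MultiForm 𝒢) : Prop :=
  ∀ n : ℕ,
    (∑ p ∈ (Finset.range (n + 2)).attach,
      castForm (by have := Finset.mem_range.mp p.2; omega)
        (insertionOp 𝒢 1 (l p.1) (l (n + 1 - p.1)))) = (0 : GForm 𝒢 n)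

end Framework

section Gerstenhaber

variable {V : Type*} [AddCommGroup V] [Module ℝ V]

/-- A Gerstenhaber algebra structure on a graded vector space `(V, 𝒜)`: a graded
commutative associative product `wedge` together with a graded Lie bracket on the
shifted space which is a degree `i` derivation in each argument. -/
structure Gerstenhaber (𝒜 : ℤ → Submodule ℝ V) : Type _ where
  wedge : V →ₗ[ℝ] V →ₗ[ℝ] V
  bracket : V →ₗ[ℝ] V →ₗ[ℝ] V
  wedge_mem : ∀ (i j : ℤ) (x y : V), x ∈ 𝒜 i → y ∈ 𝒜 j → wedge x y ∈ 𝒜 (i + j)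
  bracket_mem : ∀ (i j : ℤ) (x y : V), x ∈ 𝒜 i → y ∈ 𝒜 j → bracket x y ∈ 𝒜 (i + j - 1)
  wedge_assoc : ∀ x y z, wedge (wedge x y) z = wedge x (wedge y z)
  wedge_comm : ∀ (i j : ℤ) (x y : V), x ∈ 𝒜 i → y ∈ 𝒜 j →
    wedge x y = ((-1 : ℤ) ^ (i * j).natAbs) • wedge y x
  bracket_antisymm : ∀ (i j : ℤ) (x y : V), x ∈ 𝒜 i → y ∈ 𝒜 j →
    bracket x y = -(((-1 : ℤ) ^ ((i - 1) * (j - 1)).natAbs) • bracket y x)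
  jacobi : ∀ (i j : ℤ) (x y z : V), x ∈ 𝒜 i → y ∈ 𝒜 j →
    bracket x (bracket y z) = bracket (bracket x y) z
      + ((-1 : ℤ) ^ ((i - 1) * (j - 1)).natAbs) • bracket y (bracket x z)
  leibniz : ∀ (i j : ℤ) (x y z : V), x ∈ 𝒜 i → y ∈ 𝒜 j →
    bracket x (wedge y z) = wedge (bracket x y) z
      + ((-1 : ℤ) ^ ((i - 1) * j).natAbs) • wedge y (bracket x z)

variable {𝒜 : ℤ → Submodule ℝ V}

/-- The grading of the graded vector space `E` with `E_{-k} := A^k`. -/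
abbrev negG (𝒜 : ℤ → Submodule ℝ V) : ℤ → Submodule ℝ V := fun i => 𝒜 (-i)

/-- Iterated wedge product of `k+1` elements. -/
def wedgeAll (G : Gerstenhaber 𝒜) : {k : ℕ} → (Fin (k + 1) → V) → V
  | 0, x => x 0
  | _ + 1, x => G.wedge (x 0) (wedgeAll G (fun i => x i.succ))

/-- The symmetric vector valued `k`-form `𝒩_k (P_1, …, P_k) := P_1 ∧ ⋯ ∧ P_k`. -/
def mathcalN (G : Gerstenhaber 𝒜) (𝒢 : ℤ → Submodule ℝ V) : (k : ℕ) → GForm 𝒢 k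
  | 0 => fun _ _ => 0
  | _ + 1 => fun _ x => wedgeAll G (fun i => (x i : V))

/-- The symmetric vector valued 2-form `l_2 (P_1, P_2) := (-1)^{|P_1|} [P_1, P_2]`. -/
def l2G (G : Gerstenhaber 𝒜) (𝒢 : ℤ → Submodule ℝ V) : GForm 𝒢 2 :=
  fun d x => ((-1 : ℤ) ^ (d 0).natAbs) • G.bracket (x 0) (x 1)

/-- The family `l_1 := 0`, `l_2`, and `l_i := ι_{l_2} 𝒩_{i-1}` for `i > 2`. -/
def lFormsG (G : Gerstenhaber 𝒜) (𝒢 : ℤ → Submodule ℝ V) [DirectSum.Decomposition 𝒢] :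
    (i : ℕ) → GForm 𝒢 i
  | 0 => 0
  | 1 => 0
  | 2 => l2G G 𝒢
  | i + 3 => castForm (by omega) (insertionOp 𝒢 1 (l2G G 𝒢) (mathcalN G 𝒢 (i + 2)))

end Gerstenhaber

section Signs

/-- The sign `(-1)^n`. -/
def paritySign (n : ℤ) : ℤ := (-1 : ℤ) ^ n.natAbs

theorem paritySign_eq_ite (n : ℤ) : paritySign n = if Even n then 1 else -1 := by
  unfold paritySign
  split_ifs with h
  · exact (Int.natAbs_even.2 h).neg_one_pow
  · exact (Int.natAbs_odd.2 (Int.not_even_iff_odd.1 h)).neg_one_pow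

theorem paritySign_add (m n : ℤ) : paritySign (m + n) = paritySign m * paritySign n := by
  simp only [paritySign_eq_ite, Int.even_add]
  split_ifs <;> simp_all

theorem paritySign_mul_self (n : ℤ) : paritySign n * paritySign n = 1 := by
  rw [paritySign_eq_ite]
  split_ifs <;> simp

@[simp] theorem paritySign_zero : paritySign 0 = 1 := by simp [paritySign]

theorem paritySign_sum {ι : Type*} (S : Finset ι) (f : ι → ℤ) :
    paritySign (∑ i ∈ S, f i) = ∏ i ∈ S, paritySign (f i) := by
  classical
  induction S using Finset.induction_on with
  | empty => simp
  | insert a S ha ih => rw [sum_insert ha, prod_insert ha, paritySign_add, ih]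

variable {ι : Type*} (d : ι → ℤ)

/-- The total degree of a set of indices. -/
def totalDeg (S : Finset ι) : ℤ := ∑ i ∈ S, d i

@[simp] theorem totalDeg_singleton (i : ι) : totalDeg d {i} = d i := by simp [totalDeg]

variable [LinearOrder ι]

/-- The Koszul sign of the concatenation of the increasing enumerations of `A` and `B`. -/
def shuffleSign (A B : Finset ι) : ℤ :=
  ∏ i ∈ A, ∏ j ∈ B, if j < i then paritySign (d i * d j) else 1

variable {d}

theorem shuffleSign_union_left {A B C : Finset ι} (h : Disjoint A B) :
    shuffleSign d (A ∪ B) C = shuffleSign d A C * shuffleSign d B C :=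
  prod_union h

theorem shuffleSign_union_right {A B C : Finset ι} (h : Disjoint B C) :
    shuffleSign d A (B ∪ C) = shuffleSign d A B * shuffleSign d A C := by
  simp only [shuffleSign, prod_union h, prod_mul_distrib]

@[simp] theorem shuffleSign_empty_left (B : Finset ι) : shuffleSign d ∅ B = 1 := by
  simp [shuffleSign]

@[simp] theorem shuffleSign_empty_right (A : Finset ι) : shuffleSign d A ∅ = 1 := by
  simp [shuffleSign]

theorem shuffleSign_singleton (i j : ι) :
    shuffleSign d {i} {j} = if j < i then paritySign (d i * d j) else 1 := by
  simp [shuffleSign]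

@[simp] theorem shuffleSign_singleton_self (i : ι) : shuffleSign d {i} {i} = 1 := by
  simp [shuffleSign_singleton]

theorem shuffleSign_mul_self (A B : Finset ι) : shuffleSign d A B * shuffleSign d A B = 1 := by
  simp only [shuffleSign, ← prod_mul_distrib]
  refine prod_eq_one fun i _ => prod_eq_one fun j _ => ?_
  split_ifs <;> simp [paritySign_mul_self]

theorem shuffleSign_mul_swap {A B : Finset ι} (h : Disjoint A B) :
    shuffleSign d A B * shuffleSign d B A = paritySign (totalDeg d A * totalDeg d B) := by
  unfold shuffleSign totalDeg
  rw [sum_mul_sum, paritySign_sum, prod_comm (s := B), ← prod_mul_distrib]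
  refine prod_congr rfl fun i hi => ?_
  rw [paritySign_sum, ← prod_mul_distrib]
  refine prod_congr rfl fun j hj => ?_
  rcases lt_trichotomy i j with hij | rfl | hij
  · simp [hij, hij.not_gt, mul_comm]
  · exact absurd hj (Finset.disjoint_left.1 h hi)
  · simp [hij, hij.not_gt]

theorem shuffleSign_swap {A B : Finset ι} (h : Disjoint A B) :
    shuffleSign d B A = paritySign (totalDeg d A * totalDeg d B) * shuffleSign d A B := by
  rw [← shuffleSign_mul_swap h, mul_right_comm, shuffleSign_mul_self, one_mul]

theorem shuffleSign_eq_one {A B : Finset ι} (h : ∀ i ∈ A, ∀ j ∈ B, i ≤ j) :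
    shuffleSign d A B = 1 :=
  prod_eq_one fun i hi => prod_eq_one fun j hj => if_neg (h i hi j hj).not_gt

/-- Splitting an index set in the left entry of a `shuffleSign`. -/
theorem shuffleSign_sdiff_left {A B C : Finset ι} (h : B ⊆ A) :
    shuffleSign d A C = shuffleSign d (A \ B) C * shuffleSign d B C := by
  rw [← shuffleSign_union_left sdiff_disjoint, sdiff_union_of_subset h]

theorem shuffleSign_sdiff_right {A B C : Finset ι} (h : C ⊆ B) :
    shuffleSign d A B = shuffleSign d A (B \ C) * shuffleSign d A C := by
  rw [← shuffleSign_union_right sdiff_disjoint, sdiff_union_of_subset h]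

theorem shuffleSign_erase_left {S : Finset ι} {i : ι} (hi : i ∈ S) (C : Finset ι) :
    shuffleSign d S C = shuffleSign d (S.erase i) C * shuffleSign d {i} C := by
  rw [shuffleSign_sdiff_left (singleton_subset_iff.2 hi), erase_eq]

theorem shuffleSign_erase_right {S : Finset ι} {i : ι} (hi : i ∈ S) (A : Finset ι) :
    shuffleSign d A S = shuffleSign d A (S.erase i) * shuffleSign d A {i} := by
  rw [shuffleSign_sdiff_right (singleton_subset_iff.2 hi), erase_eq]

theorem totalDeg_erase {S : Finset ι} {i : ι} (hi : i ∈ S) :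
    totalDeg d S = totalDeg d (S.erase i) + d i := (sum_erase_add _ _ hi).symm

variable {κ : Type*} [LinearOrder κ]

theorem shuffleSign_map (e : κ ↪o ι) (A B : Finset κ) :
    shuffleSign d (A.map e.toEmbedding) (B.map e.toEmbedding) =
      shuffleSign (fun i => d (e i)) A B := by
  simp [shuffleSign]

theorem totalDeg_map (e : κ ↪o ι) (A : Finset κ) :
    totalDeg d (A.map e.toEmbedding) = totalDeg (fun i => d (e i)) A := by
  simp [totalDeg]

end Signs

section Unshuffles

theorem koszulSign_eq_shuffleSign {k l : ℕ} (d : Fin (k + l) → ℤ)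
    (σ : Equiv.Perm (Fin (k + l))) (e₁ : Fin k ↪o Fin (k + l)) (e₂ : Fin l ↪o Fin (k + l))
    (h₁ : ∀ i, σ (Fin.castAdd l i) = e₁ i) (h₂ : ∀ j, σ (Fin.natAdd k j) = e₂ j) :
    koszulSign d σ =
      shuffleSign d (univ.map e₁.toEmbedding) (univ.map e₂.toEmbedding) := by
  unfold koszulSign shuffleSign
  rw [prod_filter, Fintype.prod_prod_type, Fin.prod_univ_add]
  have h3 : ∀ (j : Fin l) (i : Fin k), ¬ Fin.natAdd k j < Fin.castAdd l i := by
    intro j i h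
    rw [Fin.lt_def] at h
    simp at h
    omega
  have h4 : ∀ (i : Fin k) (j : Fin l), Fin.castAdd l i < Fin.natAdd k j := by
    intro i j
    rw [Fin.lt_def]
    simp
    omega
  have h5 : ∀ i j : Fin k, ¬ (Fin.castAdd l i < Fin.castAdd l j ∧ j < i) :=
    fun i j h => (Fin.lt_def.1 h.1).asymm (Fin.lt_def.1 h.2)
  have h6 : ∀ i j : Fin l, ¬ (i < j ∧ j < i) := fun i j h => h.1.asymm h.2
  simp [Fin.prod_univ_add, h₁, h₂, h3, h4, h5, h6, paritySign]

/-- A sum over unshuffles is a sum over the subsets of cardinality `k`. -/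
theorem sum_unshuffles {M : Type*} [AddCommMonoid M] {k l : ℕ}
    (F : Equiv.Perm (Fin (k + l)) → M) (g : Finset (Fin (k + l)) → M)
    (h : ∀ (σ : Equiv.Perm (Fin (k + l))) (e₁ : Fin k ↪o Fin (k + l))
      (e₂ : Fin l ↪o Fin (k + l)), (∀ i, σ (Fin.castAdd l i) = e₁ i) →
      (∀ j, σ (Fin.natAdd k j) = e₂ j) →
      (univ.map e₁.toEmbedding)ᶜ = univ.map e₂.toEmbedding →
      F σ = g (univ.map e₁.toEmbedding)) :
    ∑ σ ∈ unshuffles k (k + l), F σ = ∑ A ∈ powersetCard k univ, g A := by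
  have hc : ∀ A ∈ powersetCard k (univ : Finset (Fin (k + l))), A.card = k ∧ Aᶜ.card = l := by
    intro A hA
    have := (mem_powersetCard.1 hA).2
    refine ⟨this, ?_⟩
    rw [card_compl, this]
    simp
  symm
  refine sum_bij (fun A hA => finSumFinEquiv.symm.trans
    (finSumEquivOfFinset (hc A hA).1 (hc A hA).2)) ?_ ?_ ?_ ?_
  · intro A hA
    simp only [unshuffles, mem_filter, mem_univ, true_and]
    constructor
    · intro i j hij hj
      obtain ⟨i, rfl⟩ : ∃ i', i = Fin.castAdd l i' := ⟨⟨i, by omega⟩, rfl⟩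
      obtain ⟨j, rfl⟩ : ∃ j', j = Fin.castAdd l j' := ⟨⟨j, hj⟩, rfl⟩
      have hij' : i < j := hij
      simpa using hij'
    · intro i j hij hi
      obtain ⟨i, rfl⟩ : ∃ i', i = Fin.natAdd k i' :=
        ⟨⟨i - k, by omega⟩, by ext; simp; omega⟩
      obtain ⟨j, rfl⟩ : ∃ j', j = Fin.natAdd k j' :=
        ⟨⟨j - k, by omega⟩, by ext; simp; omega⟩
      simpa using hij
  · intro A hA B hB hAB
    have h1 : ∀ (A : Finset (Fin (k + l))) (hA : A.card = k),
        A = univ.map (A.orderEmbOfFin hA).toEmbedding := fun A hA => by simp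
    rw [h1 A (hc A hA).1, h1 B (hc B hB).1]
    congr 1
    ext i
    have := congrArg (fun f => f (Fin.castAdd l i)) hAB
    simpa using congrArg Fin.val this
  · intro σ hσ
    simp only [unshuffles, mem_filter, mem_univ, true_and] at hσ
    have m₁ : StrictMono fun i => σ (Fin.castAdd l i) :=
      fun i j hij => hσ.1 _ _ hij (by simp)
    have m₂ : StrictMono fun i => σ (Fin.natAdd k i) :=
      fun i j hij => hσ.2 _ _ (by simpa using hij) (by simp)
    have hA : univ.map ⟨_, m₁.injective⟩ ∈ powersetCard k (univ : Finset (Fin (k + l))) := by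
      simp [mem_powersetCard]
    refine ⟨_, hA, ?_⟩
    ext i
    congr 1
    refine Fin.addCases (fun i => ?_) (fun j => ?_) i
    · simp only [Equiv.trans_apply, finSumFinEquiv_symm_apply_castAdd,
        finSumEquivOfFinset_inl]
      exact (congrFun (orderEmbOfFin_unique (hc _ hA).1 (fun x => by simp) m₁) i).symm
    · simp only [Equiv.trans_apply, finSumFinEquiv_symm_apply_natAdd,
        finSumEquivOfFinset_inr]
      refine (congrFun (orderEmbOfFin_unique (hc _ hA).2 (fun x => ?_) m₂) j).symm
      simp [Fin.ext_iff]
      omega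
  · intro A hA
    have := h (finSumFinEquiv.symm.trans (finSumEquivOfFinset (hc A hA).1 (hc A hA).2))
      (A.orderEmbOfFin (hc A hA).1) (Aᶜ.orderEmbOfFin (hc A hA).2)
      (fun i => by simp) (fun i => by simp) (by simp)
    rw [this]
    simp

end Unshuffles

section Operators

variable {V : Type*} [AddCommGroup V] [Module ℝ V] {𝒜 : ℤ → Submodule ℝ V}

namespace Gerstenhaber

variable (G : Gerstenhaber 𝒜)

theorem wedge_comm' {i j : ℤ} {x y : V} (hx : x ∈ 𝒜 i) (hy : y ∈ 𝒜 j) :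
    G.wedge x y = paritySign (i * j) • G.wedge y x :=
  G.wedge_comm i j x y hx hy

theorem bracket_antisymm' {i j : ℤ} {x y : V} (hx : x ∈ 𝒜 i) (hy : y ∈ 𝒜 j) :
    G.bracket x y = -(paritySign ((i - 1) * (j - 1)) • G.bracket y x) :=
  G.bracket_antisymm i j x y hx hy

theorem bracket_wedge_left {i j k : ℤ} {x y z : V} (hx : x ∈ 𝒜 i) (hy : y ∈ 𝒜 j)
    (hz : z ∈ 𝒜 k) :
    G.bracket (G.wedge y z) x =
      G.wedge y (G.bracket z x) + paritySign (k * (i - 1)) • G.wedge (G.bracket y x) z := by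
  have h := G.leibniz i j x y z hx hy
  change _ = _ + paritySign ((i - 1) * j) • _ at h
  rw [G.bracket_antisymm' (G.wedge_mem j k y z hy hz) hx, h, G.bracket_antisymm' hx hy,
    G.bracket_antisymm' hx hz]
  simp only [paritySign_eq_ite, Int.even_mul, Int.even_sub, Int.even_add, map_neg, map_zsmul,
    LinearMap.neg_apply, LinearMap.smul_apply]
  by_cases hi : Even i <;> by_cases hj : Even j <;> by_cases hk : Even k <;>
    simp [hi, hj, hk, add_comm]

theorem bracket_bracket_cyclic {i j k : ℤ} {x y z : V} (hx : x ∈ 𝒜 i) (hy : y ∈ 𝒜 j)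
    (hz : z ∈ 𝒜 k) :
    G.bracket (G.bracket x y) z =
      -(paritySign ((i - 1) * (j + k)) • G.bracket (G.bracket y z) x) -
        paritySign ((k - 1) * (i + j)) • G.bracket (G.bracket z x) y := by
  have h := G.jacobi i j x y z hx hy
  change _ = _ + paritySign ((i - 1) * (j - 1)) • _ at h
  rw [G.bracket_antisymm' hx (G.bracket_mem j k y z hy hz),
    G.bracket_antisymm' hy (G.bracket_mem i k x z hx hz), G.bracket_antisymm' hx hz] at h
  rw [← sub_eq_iff_eq_add] at h
  rw [← h]
  simp only [paritySign_eq_ite, Int.even_mul, Int.even_sub, Int.even_add, map_neg, map_zsmul,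
    LinearMap.neg_apply, LinearMap.smul_apply]
  by_cases hi : Even i <;> by_cases hj : Even j <;> by_cases hk : Even k <;>
    simp [hi, hj, hk, sub_eq_add_neg]

variable {ι : Type*} [LinearOrder ι] (d : ι → ℤ) (x : ι → V)

/-- Right multiplication of a family indexed by finite sets by the variables `x i`. -/
def wedgeOp : (Finset ι → V) →ₗ[ℝ] (Finset ι → V) :=
  LinearMap.pi fun S => ∑ i ∈ S,
    shuffleSign d S {i} • (G.wedge.flip (x i) ∘ₗ LinearMap.proj (S.erase i))

theorem wedgeOp_apply (F : Finset ι → V) (S : Finset ι) :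
    G.wedgeOp d x F S = ∑ i ∈ S, shuffleSign d S {i} • G.wedge (F (S.erase i)) (x i) := by
  simp [wedgeOp]

/-- The signed bracket of a family of degree `p` with the variables `x i`. -/
def bracketOp (p : ℤ) : (Finset ι → V) →ₗ[ℝ] (Finset ι → V) :=
  LinearMap.pi fun S => ∑ i ∈ S,
    (shuffleSign d S {i} * paritySign (p + totalDeg d (S.erase i))) •
      (G.bracket.flip (x i) ∘ₗ LinearMap.proj (S.erase i))

theorem bracketOp_apply (p : ℤ) (F : Finset ι → V) (S : Finset ι) :
    G.bracketOp d x p F S = ∑ i ∈ S,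
      (shuffleSign d S {i} * paritySign (p + totalDeg d (S.erase i))) •
        G.bracket (F (S.erase i)) (x i) := by
  simp [bracketOp]

/-- The symmetrized bracket of the variables, supported on sets with two elements. -/
def selfBracket (B : Finset ι) : V :=
  ∑ i ∈ B, ∑ j ∈ B.erase i,
    if B = {i, j} then (shuffleSign d B {i} * paritySign (d j)) • G.bracket (x j) (x i) else 0

/-- Right multiplication of a family of degree `p` by `selfBracket`. -/
def quadOp (p : ℤ) : (Finset ι → V) →ₗ[ℝ] (Finset ι → V) :=
  LinearMap.pi fun S => ∑ B ∈ S.powerset,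
    (shuffleSign d (S \ B) B * paritySign (p + totalDeg d (S \ B))) •
      (G.wedge.flip (G.selfBracket d x B) ∘ₗ LinearMap.proj (S \ B))

theorem quadOp_apply (p : ℤ) (F : Finset ι → V) (S : Finset ι) :
    G.quadOp d x p F S = ∑ B ∈ S.powerset,
      (shuffleSign d (S \ B) B * paritySign (p + totalDeg d (S \ B))) •
        G.wedge (F (S \ B)) (G.selfBracket d x B) := by
  simp [quadOp]

variable (𝒜) in
/-- The family `F` is homogeneous of degree `p` relative to the degrees of the variables. -/
def HasDeg (p : ℤ) (F : Finset ι → V) : Prop := ∀ S, F S ∈ 𝒜 (-(totalDeg d S + p))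

variable {G d x}

theorem mem_of_eq {i j : ℤ} {v : V} (h : v ∈ 𝒜 i) (hij : i = j) : v ∈ 𝒜 j := hij ▸ h

theorem hasDeg_wedgeOp (hx : ∀ i, x i ∈ 𝒜 (-d i)) {p : ℤ} {F : Finset ι → V}
    (hF : HasDeg 𝒜 d p F) : HasDeg 𝒜 d p (G.wedgeOp d x F) := by
  intro S
  rw [wedgeOp_apply]
  refine Submodule.sum_mem _ fun i hi => zsmul_mem ?_ _
  refine mem_of_eq (G.wedge_mem _ _ _ _ (hF _) (hx i)) ?_
  rw [totalDeg_erase hi]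
  ring

theorem hasDeg_selfBracket (hx : ∀ i, x i ∈ 𝒜 (-d i)) :
    HasDeg 𝒜 d 1 (G.selfBracket d x) := by
  intro S
  refine Submodule.sum_mem _ fun i hi => Submodule.sum_mem _ fun j hj => ?_
  split_ifs with h
  · refine zsmul_mem (mem_of_eq (G.bracket_mem _ _ _ _ (hx j) (hx i)) ?_) _
    rw [h, totalDeg, sum_pair (ne_of_mem_erase hj).symm]
    ring
  · exact zero_mem _

theorem hasDeg_wedgeOp_iterate (hx : ∀ i, x i ∈ 𝒜 (-d i)) {p : ℤ} {F : Finset ι → V}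
    (hF : HasDeg 𝒜 d p F) (k : ℕ) : HasDeg 𝒜 d p ((G.wedgeOp d x ^ k) F) := by
  induction k with
  | zero => simpa using hF
  | succ k ih => rw [pow_succ', Module.End.mul_apply]; exact hasDeg_wedgeOp hx ih

theorem selfBracket_pair (hx : ∀ i, x i ∈ 𝒜 (-d i)) {i j : ι} (hij : i ≠ j) :
    G.selfBracket d x {i, j} =
      (2 * shuffleSign d {i} {j} * paritySign (d i)) • G.bracket (x i) (x j) := by
  have h1 : ({i, j} : Finset ι).erase i = {j} := by ext; simp; grind
  have h2 : ({i, j} : Finset ι).erase j = {i} := by ext; simp; grind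
  have h3 : ({i, j} : Finset ι) = {j, i} := pair_comm i j
  have h4 : shuffleSign d {i, j} {i} = shuffleSign d {j} {i} := by
    rw [shuffleSign_erase_left (i := i) (by simp), h1]; simp
  have h5 : shuffleSign d {i, j} {j} = shuffleSign d {i} {j} := by
    rw [shuffleSign_erase_left (i := j) (by simp), h2]; simp
  rw [selfBracket, sum_pair hij, h1, h2, sum_singleton, sum_singleton, if_pos rfl, if_pos h3,
    h4, h5, shuffleSign_swap (A := {i}) (by simpa using hij), G.bracket_antisymm' (hx j) (hx i)]
  simp only [paritySign_eq_ite, totalDeg_singleton, Int.even_mul, Int.even_sub, even_neg]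
  by_cases hi : Even (d i) <;> by_cases hj : Even (d j) <;> simp [hi, hj] <;> module

theorem selfBracket_eq_zero {B : Finset ι} (hB : B.card ≠ 2) : G.selfBracket d x B = 0 := by
  refine sum_eq_zero fun i hi => sum_eq_zero fun j hj => if_neg fun h => hB ?_
  rw [h, card_pair (ne_of_mem_erase hj).symm]

theorem quadOp_apply' (p : ℤ) (F : Finset ι → V) (S : Finset ι) :
    G.quadOp d x p F S = ∑ i ∈ S, ∑ j ∈ S.erase i,
      (shuffleSign d S {i} * shuffleSign d (S.erase i) {j} *
        paritySign (p + totalDeg d ((S.erase i).erase j) + d j)) •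
        G.wedge (F ((S.erase i).erase j)) (G.bracket (x j) (x i)) := by
  rw [quadOp_apply]
  simp only [selfBracket, map_sum, smul_sum]
  rw [sum_comm' (t' := S) (s' := fun i => S.powerset.filter fun B => i ∈ B) (by
    intro B i; simp only [mem_powerset, mem_filter]; grind)]
  refine sum_congr rfl fun i hi => ?_
  rw [sum_comm' (t' := S.erase i)
    (s' := fun j => S.powerset.filter fun B => i ∈ B ∧ j ∈ B) (by
    intro B i; simp only [mem_powerset, mem_filter, mem_erase]; grind)]
  refine sum_congr rfl fun j hj => ?_
  have hji := ne_of_mem_erase hj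
  have hsub : {i, j} ⊆ S := by
    simp [insert_subset_iff, hi, mem_of_mem_erase hj]
  rw [sum_eq_single {i, j}]
  · have h1 : S \ {i, j} = (S.erase i).erase j := by ext; simp; grind
    have h2 : shuffleSign d {i, j} {i} = shuffleSign d {j} {i} := by
      rw [shuffleSign_erase_left (i := i) (by simp)]
      have : ({i, j} : Finset ι).erase i = {j} := by ext; simp; grind
      simp [this]
    have h3 : shuffleSign d ((S.erase i).erase j) {i, j} =
        shuffleSign d ((S.erase i).erase j) {i} * shuffleSign d ((S.erase i).erase j) {j} := by
      rw [← shuffleSign_union_right (by simpa using hji.symm)]; rfl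
    rw [if_pos rfl, h1, h2, h3, shuffleSign_erase_left hi, shuffleSign_erase_left hj,
      shuffleSign_erase_left hj, shuffleSign_singleton_self, shuffleSign_singleton_self,
      paritySign_add _ (d j), map_zsmul, smul_smul]
    congr 1
    ring
  · intro B _ hB
    simp [hB]
  · intro h
    simp at h
    exact absurd hsub h

theorem shuffleSign_erase_swap {S : Finset ι} {i j : ι} (hi : i ∈ S) (hj : j ∈ S)
    (hij : i ≠ j) :
    shuffleSign d S {i} * shuffleSign d (S.erase i) {j} * paritySign (d i * d j) =
      shuffleSign d S {j} * shuffleSign d (S.erase j) {i} := by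
  have h := shuffleSign_mul_swap (d := d) (A := {i}) (B := {j}) (by simpa using hij)
  rw [totalDeg_singleton, totalDeg_singleton] at h
  rw [← h, shuffleSign_erase_left hi {i}, shuffleSign_erase_left hj {j},
    shuffleSign_erase_left (mem_erase.2 ⟨hij.symm, hj⟩) {i},
    shuffleSign_erase_left (mem_erase.2 ⟨hij.symm, hj⟩) {j},
    shuffleSign_erase_left (mem_erase.2 ⟨hij, hi⟩) {i},
    shuffleSign_erase_left (mem_erase.2 ⟨hij, hi⟩) {j}, erase_right_comm (a := j) (b := i),
    shuffleSign_singleton_self, shuffleSign_singleton_self]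
  have h1 := shuffleSign_mul_self (d := d) {j} {i}
  linear_combination (shuffleSign d ((S.erase i).erase j) {i} *
    shuffleSign d ((S.erase i).erase j) {j} * shuffleSign d {i} {j}) * h1

theorem sum_erase_comm {M : Type*} [AddCommMonoid M] (S : Finset ι) (f : ι → ι → M) :
    ∑ i ∈ S, ∑ j ∈ S.erase i, f i j = ∑ j ∈ S, ∑ i ∈ S.erase j, f i j :=
  sum_comm' fun i j => by simp only [mem_erase]; grind

theorem bracketOp_wedgeOp (hx : ∀ i, x i ∈ 𝒜 (-d i)) {p : ℤ} {F : Finset ι → V}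
    (hF : HasDeg 𝒜 d p F) :
    G.bracketOp d x p (G.wedgeOp d x F) =
      G.wedgeOp d x (G.bracketOp d x p F) + G.quadOp d x p F := by
  ext S
  rw [Pi.add_apply, quadOp_apply', bracketOp_apply, wedgeOp_apply]
  simp only [wedgeOp_apply, bracketOp_apply, map_sum, LinearMap.sum_apply, smul_sum]
  rw [sum_erase_comm S (fun i j => shuffleSign d S {i} • _), ← sum_add_distrib]
  refine sum_congr rfl fun i hi => ?_
  rw [← sum_add_distrib]
  refine sum_congr rfl fun j hj => ?_
  obtain ⟨hji, hj'⟩ := mem_erase.1 hj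
  rw [map_zsmul, LinearMap.smul_apply, G.bracket_wedge_left (hx i) (hF _) (hx j), map_zsmul,
    LinearMap.smul_apply, erase_right_comm (a := j) (b := i), totalDeg_erase hj]
  have h := shuffleSign_erase_swap (d := d) hi hj' hji.symm
  simp only [smul_smul, smul_add]
  rw [add_comm]
  congr 2
  · have e : paritySign (p + (totalDeg d ((S.erase i).erase j) + d j)) *
        paritySign (-d j * (-d i - 1)) =
        paritySign (d i * d j) * paritySign (p + totalDeg d ((S.erase i).erase j)) := by
      simp only [paritySign_eq_ite, Int.even_mul, Int.even_sub, even_neg, Int.even_add]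
      by_cases hi : Even (d i) <;> by_cases hj : Even (d j) <;> by_cases hp : Even p <;>
        by_cases hS : Even (totalDeg d ((S.erase i).erase j)) <;> simp [hi, hj, hp, hS]
    linear_combination (shuffleSign d S {i} * shuffleSign d (S.erase i) {j}) * e +
      paritySign (p + totalDeg d ((S.erase i).erase j)) * h
  · rw [add_assoc]
    ring

theorem quadOp_wedgeOp (hx : ∀ i, x i ∈ 𝒜 (-d i)) (p : ℤ) (F : Finset ι → V) :
    G.quadOp d x p (G.wedgeOp d x F) = G.wedgeOp d x (G.quadOp d x p F) := by
  ext S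
  rw [quadOp_apply, wedgeOp_apply]
  simp only [wedgeOp_apply, quadOp_apply, map_sum, LinearMap.sum_apply, smul_sum]
  rw [sum_comm' (t' := S) (s' := fun i => (S.erase i).powerset) (by
    intro B i; simp only [mem_powerset, mem_sdiff, subset_erase]; grind)]
  refine sum_congr rfl fun i hi => sum_congr rfl fun B hB => ?_
  obtain ⟨hBS, hiB⟩ := subset_erase.1 (mem_powerset.1 hB)
  have hiS : i ∈ S \ B := mem_sdiff.2 ⟨hi, hiB⟩
  rw [map_zsmul, map_zsmul, LinearMap.smul_apply, LinearMap.smul_apply, G.wedge_assoc,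
    G.wedge_assoc, G.wedge_comm' (hx i) (hasDeg_selfBracket hx B), map_zsmul,
    erase_sdiff_comm]
  simp only [smul_smul]
  congr 1
  rw [shuffleSign_sdiff_left hBS (C := {i}), shuffleSign_erase_left hiS B,
    totalDeg_erase hiS, shuffleSign_swap (A := {i}) (B := B) (by simpa using hiB),
    totalDeg_singleton]
  simp only [paritySign_eq_ite, Int.even_mul, even_neg, Int.even_add]
  by_cases hi : Even (d i) <;> by_cases hj : Even (totalDeg d B) <;> by_cases hp : Even p <;>
    by_cases hS : Even (totalDeg d ((S \ B).erase i)) <;> simp [hi, hj, hp, hS] <;> ring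

theorem quadOp_selfBracket (hx : ∀ i, x i ∈ 𝒜 (-d i)) :
    G.quadOp d x 1 (G.selfBracket d x) = 0 := by
  ext S
  have key : ∀ B ∈ S.powerset,
      (shuffleSign d (S \ B) B * paritySign (1 + totalDeg d (S \ B))) •
        G.wedge (G.selfBracket d x (S \ B)) (G.selfBracket d x B) =
      -((shuffleSign d B (S \ B) * paritySign (1 + totalDeg d B)) •
        G.wedge (G.selfBracket d x B) (G.selfBracket d x (S \ B))) := by
    intro B hB
    rw [G.wedge_comm' (hasDeg_selfBracket hx (S \ B)) (hasDeg_selfBracket hx B),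
      shuffleSign_swap (A := B) disjoint_sdiff, smul_smul, ← neg_smul]
    congr 1
    simp only [paritySign_eq_ite, Int.even_mul, even_neg, Int.even_add]
    by_cases hi : Even (totalDeg d B) <;> by_cases hj : Even (totalDeg d (S \ B)) <;>
      simp [hi, hj]
  have h : G.quadOp d x 1 (G.selfBracket d x) S = -G.quadOp d x 1 (G.selfBracket d x) S := by
    conv_lhs => rw [quadOp_apply, sum_congr rfl key, sum_neg_distrib]
    rw [quadOp_apply]
    congr 1
    refine sum_nbij' (fun B => S \ B) (fun B => S \ B) ?_ ?_ ?_ ?_ ?_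
    · simp
    · simp
    · intro B hB; simpa using mem_powerset.1 hB
    · intro B hB; simpa using mem_powerset.1 hB
    · intro B hB
      rw [Finset.sdiff_sdiff_eq_self (mem_powerset.1 hB)]
  have h2 : (2 : ℝ) • G.quadOp d x 1 (G.selfBracket d x) S = 0 := by
    rw [two_smul]
    nth_rewrite 1 [h]
    exact neg_add_cancel _
  simpa using h2

theorem bracketOp_selfBracket (hx : ∀ i, x i ∈ 𝒜 (-d i)) :
    G.bracketOp d x 1 (G.selfBracket d x) = 0 := by
  ext S
  rw [bracketOp_apply, Pi.zero_apply]
  by_cases hS : S.card = 3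
  · obtain ⟨i, j, k, hij, hik, hjk, rfl⟩ := card_eq_three.1 hS
    have e1 : ({i, j, k} : Finset ι).erase i = {j, k} := by ext; simp; grind
    have e2 : ({i, j, k} : Finset ι).erase j = {i, k} := by ext; simp; grind
    have e3 : ({i, j, k} : Finset ι).erase k = {i, j} := by ext; simp; grind
    have s1 : ∀ a b c : ι, a ≠ b → shuffleSign d {a, b} {c} =
        shuffleSign d {a} {c} * shuffleSign d {b} {c} := fun a b c h => by
      rw [← shuffleSign_union_left (by simpa using h)]; rfl
    have t1 : shuffleSign d {i, j, k} {i} = shuffleSign d {j} {i} * shuffleSign d {k} {i} := by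
      rw [shuffleSign_erase_left (i := i) (by simp), e1, s1 _ _ _ hjk]; simp
    have t2 : shuffleSign d {i, j, k} {j} = shuffleSign d {i} {j} * shuffleSign d {k} {j} := by
      rw [shuffleSign_erase_left (i := j) (by simp), e2, s1 _ _ _ hik]; simp
    have t3 : shuffleSign d {i, j, k} {k} = shuffleSign d {i} {k} * shuffleSign d {j} {k} := by
      rw [shuffleSign_erase_left (i := k) (by simp), e3, s1 _ _ _ hij]; simp
    have w : ∀ a b : ι, a ≠ b → totalDeg d {a, b} = d a + d b := fun a b h => sum_pair h
    rw [sum_insert (by simp [hij, hik]), sum_pair hjk, e1, e2, e3, t1, t2, t3,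
      selfBracket_pair hx hij, selfBracket_pair hx hik, selfBracket_pair hx hjk,
      w _ _ hij, w _ _ hik, w _ _ hjk,
      shuffleSign_swap (A := {i}) (B := {j}) (by simpa using hij),
      shuffleSign_swap (A := {i}) (B := {k}) (by simpa using hik),
      shuffleSign_swap (A := {j}) (B := {k}) (by simpa using hjk)]
    simp only [map_zsmul, LinearMap.smul_apply, totalDeg_singleton]
    rw [G.bracket_bracket_cyclic (hx i) (hx j) (hx k), G.bracket_antisymm' (hx i) (hx k)]
    simp only [paritySign_eq_ite, Int.even_mul, Int.even_sub, even_neg, Int.even_add,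
      map_zsmul, LinearMap.smul_apply, map_neg, LinearMap.neg_apply]
    by_cases hi : Even (d i) <;> by_cases hj : Even (d j) <;> by_cases hk : Even (d k) <;>
      simp [hi, hj, hk] <;> module
  · refine sum_eq_zero fun i hi => ?_
    rw [selfBracket_eq_zero, map_zero, LinearMap.zero_apply, smul_zero]
    rw [card_erase_of_mem hi]
    have := card_pos.2 ⟨i, hi⟩
    omega

theorem quadOp_wedgeOp_iterate (hx : ∀ i, x i ∈ 𝒜 (-d i)) (k : ℕ) :
    G.quadOp d x 1 ((G.wedgeOp d x ^ k) (G.selfBracket d x)) = 0 := by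
  induction k with
  | zero => simpa using quadOp_selfBracket hx
  | succ k ih => rw [pow_succ', Module.End.mul_apply, quadOp_wedgeOp hx, ih, map_zero]

theorem bracketOp_wedgeOp_iterate (hx : ∀ i, x i ∈ 𝒜 (-d i)) (k : ℕ) :
    G.bracketOp d x 1 ((G.wedgeOp d x ^ k) (G.selfBracket d x)) = 0 := by
  induction k with
  | zero => simpa using bracketOp_selfBracket hx
  | succ k ih =>
    rw [pow_succ', Module.End.mul_apply,
      bracketOp_wedgeOp hx (hasDeg_wedgeOp_iterate hx (hasDeg_selfBracket hx) k), ih,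
      quadOp_wedgeOp_iterate hx, map_zero, add_zero]

end Gerstenhaber

end Operators

section Expansion

variable {V : Type*} [AddCommGroup V] [Module ℝ V] {𝒜 : ℤ → Submodule ℝ V}

namespace Gerstenhaber

variable (G : Gerstenhaber 𝒜) {ι κ : Type*} [LinearOrder ι] [LinearOrder κ]

/-- Successive right multiplication by the variables listed in `l`. -/
def mulList (x : ι → V) : List ι → V →ₗ[ℝ] V
  | [] => LinearMap.id
  | i :: l => mulList x l ∘ₗ G.wedge.flip (x i)

/-- Successive right multiplication by the variables `x i`, `i ∈ C`, in increasing order. -/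
def mulSet (x : ι → V) (C : Finset ι) : V →ₗ[ℝ] V := G.mulList x (C.sort (· ≤ ·))

@[simp] theorem mulSet_empty (x : ι → V) (y : V) : G.mulSet x ∅ y = y := by
  simp [mulSet, mulList]

variable {G}

theorem mulSet_insert_min (x : ι → V) {i : ι} {C : Finset ι} (h : ∀ j ∈ C, i < j) (y : V) :
    G.mulSet x (insert i C) y = G.mulSet x C (G.wedge y (x i)) := by
  rw [mulSet, sort_insert _ (fun j hj => (h j hj).le) (fun hi => lt_irrefl _ (h i hi))]
  rfl

theorem wedge_mulSet {d : ι → ℤ} {x : ι → V} (hx : ∀ i, x i ∈ 𝒜 (-d i)) (C : Finset ι) {i : ι}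
    (hi : i ∉ C) (y : V) :
    G.wedge (G.mulSet x C y) (x i) = shuffleSign d C {i} • G.mulSet x (insert i C) y := by
  induction C using Finset.induction_on_min generalizing y with
  | empty => rw [mulSet_insert_min x (by simp)]; simp
  | insert m C hm ih =>
    simp only [mem_insert, not_or] at hi
    have hmC : Disjoint {m} C := by simpa using fun h => lt_irrefl _ (hm m h)
    rw [mulSet_insert_min x hm, ih hi.2, insert_eq m C, shuffleSign_union_left hmC, ← insert_eq,
      shuffleSign_singleton]
    rcases lt_or_gt_of_ne hi.1 with h | h
    · have h1 : ∀ j ∈ C, i < j := fun j hj => h.trans (hm j hj)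
      have h2 : ∀ j ∈ insert m C, i < j := by simpa [h] using h1
      rw [mulSet_insert_min x h1, mulSet_insert_min x h2, mulSet_insert_min x hm, if_pos h,
        G.wedge_assoc, G.wedge_assoc, G.wedge_comm' (hx m) (hx i), map_zsmul, map_zsmul, smul_smul,
        neg_mul_neg, mul_comm]
    · have h2 : ∀ j ∈ insert i C, m < j := by simpa [h] using hm
      rw [Finset.insert_comm, mulSet_insert_min x h2, if_neg h.not_gt, one_mul]

theorem mulSet_map (e : κ ↪o ι) (x : ι → V) (C : Finset κ) (y : V) :
    G.mulSet x (C.map e.toEmbedding) y = G.mulSet (fun i => x (e i)) C y := by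
  induction C using Finset.induction_on_min generalizing y with
  | empty => simp
  | insert m C hm ih =>
    rw [map_insert, mulSet_insert_min _ hm, mulSet_insert_min _ (by simpa using hm), ih]
    rfl

theorem selfBracket_map (e : κ ↪o ι) (d : ι → ℤ) (x : ι → V) (B : Finset κ) :
    G.selfBracket d x (B.map e.toEmbedding) =
      G.selfBracket (fun i => d (e i)) (fun i => x (e i)) B := by
  simp only [selfBracket, sum_map]
  refine sum_congr rfl fun i hi => ?_
  rw [RelEmbedding.coe_toEmbedding, ← e.coe_toEmbedding, ← map_erase, sum_map]
  refine sum_congr rfl fun j hj => ?_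
  have h1 : ({e.toEmbedding i, e.toEmbedding j} : Finset ι) =
      ({i, j} : Finset κ).map e.toEmbedding := by
    simp
  have h2 : ({e.toEmbedding i} : Finset ι) = ({i} : Finset κ).map e.toEmbedding := by simp
  simp only [h1, h2, shuffleSign_map, Finset.map_inj]
  rfl

theorem univ_fin_succ (l : ℕ) :
    (univ : Finset (Fin (l + 1))) = insert 0 (univ.map (Fin.succOrderEmb l).toEmbedding) := by
  ext i
  refine Fin.cases ?_ (fun i => ?_) i <;> simp

theorem wedgeAll_cons_wedge : ∀ {k : ℕ} (y z : V) (w : Fin k → V),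
    wedgeAll G (Fin.cons (G.wedge y z) w : Fin (k + 1) → V) =
      G.wedge y (wedgeAll G (Fin.cons z w : Fin (k + 1) → V))
  | 0, _, _, _ => rfl
  | _ + 1, y, z, _ => G.wedge_assoc y z _

theorem wedgeAll_cons {k : ℕ} (y : V) (z : Fin k → V) :
    wedgeAll G (Fin.cons y z : Fin (k + 1) → V) = G.mulSet z univ y := by
  induction k generalizing y with
  | zero => simp [wedgeAll]
  | succ k ih =>
    rw [univ_fin_succ, mulSet_insert_min z (by simp [Fin.pos_iff_ne_zero]), mulSet_map]
    change _ = G.mulSet (fun i : Fin k => z i.succ) _ _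
    rw [← ih, wedgeAll_cons_wedge]
    obtain ⟨z0, w, rfl⟩ : ∃ z0 w, z = Fin.cons z0 w :=
      ⟨z 0, Fin.tail z, (Fin.cons_self_tail z).symm⟩
    rfl

variable (G) in
/-- The symmetrization of twice the bracket of two variables times all the others. -/
def bracketSum (d : ι → ℤ) (x : ι → V) (S : Finset ι) : V :=
  ∑ B ∈ powersetCard 2 S, shuffleSign d B (S \ B) • G.mulSet x (S \ B) (G.selfBracket d x B)

theorem sum_powersetCard_map {M : Type*} [AddCommMonoid M] (e : κ ↪o ι) (k : ℕ) (C : Finset κ)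
    (f : Finset ι → M) :
    ∑ B ∈ powersetCard k (C.map e.toEmbedding), f B =
      ∑ B ∈ powersetCard k C, f (B.map e.toEmbedding) := by
  rw [powersetCard_map, sum_map]
  rfl

theorem bracketSum_map (e : κ ↪o ι) (d : ι → ℤ) (x : ι → V) (S : Finset κ) :
    G.bracketSum d x (S.map e.toEmbedding) =
      G.bracketSum (fun i => d (e i)) (fun i => x (e i)) S := by
  rw [bracketSum, sum_powersetCard_map]
  refine sum_congr rfl fun B _ => ?_
  rw [← Finset.map_sdiff, shuffleSign_map, mulSet_map, selfBracket_map]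

/-- Iterated multiplications, in terms of `mulSet`. -/
theorem wedgeOp_iterate_apply {d : ι → ℤ} {x : ι → V} (hx : ∀ i, x i ∈ 𝒜 (-d i))
    (F : Finset ι → V) (k : ℕ) (S : Finset ι) :
    (G.wedgeOp d x ^ k) F S = k.factorial •
      ∑ C ∈ powersetCard k S, shuffleSign d (S \ C) C • G.mulSet x C (F (S \ C)) := by
  induction k generalizing S with
  | zero => simp
  | succ k ih =>
    rw [pow_succ', Module.End.mul_apply, wedgeOp_apply]
    simp only [ih, map_nsmul, LinearMap.smul_apply, map_sum, LinearMap.sum_apply, map_zsmul]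
    simp only [smul_comm _ (k.factorial), ← smul_sum]
    rw [Nat.factorial_succ, mul_comm, mul_smul]
    congr 1
    have h : (k + 1) • ∑ C ∈ powersetCard (k + 1) S,
        shuffleSign d (S \ C) C • G.mulSet x C (F (S \ C)) =
        ∑ C ∈ powersetCard (k + 1) S, ∑ i ∈ C,
          shuffleSign d (S \ C) C • G.mulSet x C (F (S \ C)) := by
      rw [smul_sum]
      refine sum_congr rfl fun C hC => ?_
      rw [sum_const, (mem_powersetCard.1 hC).2]
    rw [h]
    simp only [smul_sum]
    rw [sum_sigma', sum_sigma']
    refine sum_bij' (fun a _ => ⟨insert a.1 a.2, a.1⟩) (fun a _ => ⟨a.2, a.1.erase a.2⟩)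
      ?_ ?_ ?_ ?_ ?_
    · rintro ⟨i, C⟩ h
      simp only [mem_sigma, mem_powersetCard, subset_erase] at h ⊢
      obtain ⟨hi, ⟨hC, hiC⟩, hk⟩ := h
      exact ⟨⟨insert_subset hi hC, by rw [card_insert_of_notMem hiC, hk]⟩, mem_insert_self _ _⟩
    · rintro ⟨C, i⟩ h
      simp only [mem_sigma, mem_powersetCard] at h ⊢
      obtain ⟨⟨hC, hk⟩, hi⟩ := h
      exact ⟨hC hi, erase_subset_erase _ hC, by rw [card_erase_of_mem hi, hk]; rfl⟩
    · rintro ⟨i, C⟩ h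
      simp only [mem_sigma, mem_powersetCard, subset_erase] at h
      simp [erase_insert h.2.1.2]
    · rintro ⟨C, i⟩ h
      simp only [mem_sigma] at h
      simp [insert_erase h.2]
    · rintro ⟨i, C⟩ h
      simp only [mem_sigma, mem_powersetCard, subset_erase] at h ⊢
      obtain ⟨hi, ⟨hC, hiC⟩, hk⟩ := h
      have hd : Disjoint {i} C := by simpa using hiC
      have e1 : S.erase i \ C = S \ insert i C := by ext; simp; grind
      rw [wedge_mulSet hx C hiC, smul_smul, smul_smul, e1,
        shuffleSign_sdiff_left (C := {i}) (insert_subset hi hC), insert_eq,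
        shuffleSign_union_left hd, shuffleSign_union_right hd, shuffleSign_singleton_self]
      congr 1
      linear_combination (shuffleSign d (S \ ({i} ∪ C)) {i} * shuffleSign d (S \ ({i} ∪ C)) C) *
        shuffleSign_mul_self (d := d) C {i}

theorem wedgeOp_iterate_selfBracket {d : ι → ℤ} {x : ι → V} (hx : ∀ i, x i ∈ 𝒜 (-d i))
    {k : ℕ} {S : Finset ι} (hS : S.card = k + 2) :
    (G.wedgeOp d x ^ k) (G.selfBracket d x) S = k.factorial • G.bracketSum d x S := by
  rw [wedgeOp_iterate_apply hx, bracketSum]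
  congr 1
  refine sum_bij' (fun C _ => S \ C) (fun B _ => S \ B) ?_ ?_ ?_ ?_ ?_
  · intro C hC
    obtain ⟨hC, hk⟩ := mem_powersetCard.1 hC
    simp [card_sdiff_of_subset hC, hk, hS]
  · intro C hC
    obtain ⟨hC, hk⟩ := mem_powersetCard.1 hC
    simp [card_sdiff_of_subset hC, hk, hS]
  · intro C hC
    exact Finset.sdiff_sdiff_eq_self (mem_powersetCard.1 hC).1
  · intro C hC
    exact Finset.sdiff_sdiff_eq_self (mem_powersetCard.1 hC).1
  · intro C hC
    rw [Finset.sdiff_sdiff_eq_self (mem_powersetCard.1 hC).1]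

theorem wedgeOp_iterate_selfBracket_eq_zero {d : ι → ℤ} {x : ι → V} (hx : ∀ i, x i ∈ 𝒜 (-d i))
    {k : ℕ} {S : Finset ι} (hS : S.card ≠ k + 2) :
    (G.wedgeOp d x ^ k) (G.selfBracket d x) S = 0 := by
  rw [wedgeOp_iterate_apply hx, sum_eq_zero, smul_zero]
  intro C hC
  obtain ⟨hC, hk⟩ := mem_powersetCard.1 hC
  have := card_sdiff_add_card_eq_card hC
  rw [selfBracket_eq_zero (by omega), map_zero, smul_zero]

variable (G) in
/-- The value of `bracketSum` on `y` of degree `D` followed by the variables indexed by `C`. -/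
def consSum (D : ℤ) (y : V) (d : ι → ℤ) (x : ι → V) (C : Finset ι) : V :=
  ∑ c ∈ C, (shuffleSign d {c} (C.erase c) * (2 * paritySign D)) •
      G.mulSet x (C.erase c) (G.bracket y (x c)) +
    ∑ B ∈ powersetCard 2 C, (paritySign (D * totalDeg d B) * shuffleSign d B (C \ B)) •
      G.mulSet x (C \ B) (G.wedge (G.selfBracket d x B) y)

theorem consSum_map (e : κ ↪o ι) (D : ℤ) (y : V) (d : ι → ℤ) (x : ι → V) (C : Finset κ) :
    G.consSum D y d x (C.map e.toEmbedding) =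
      G.consSum D y (fun i => d (e i)) (fun i => x (e i)) C := by
  rw [consSum, sum_map, sum_powersetCard_map]
  refine congrArg₂ _ (sum_congr rfl fun c _ => ?_) (sum_congr rfl fun B _ => ?_)
  · rw [← map_erase, ← map_singleton, shuffleSign_map, mulSet_map]
    rfl
  · rw [← Finset.map_sdiff, totalDeg_map, shuffleSign_map, mulSet_map, selfBracket_map]

theorem bracketSum_insert_min {d : ι → ℤ} {x : ι → V} (hx : ∀ i, x i ∈ 𝒜 (-d i)) {i : ι}
    {C : Finset ι} (h : ∀ j ∈ C, i < j) :
    G.bracketSum d x (insert i C) = G.consSum (d i) (x i) d x C := by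
  have hi : i ∉ C := fun hi => lt_irrefl _ (h i hi)
  rw [bracketSum, powersetCard_succ_insert hi, sum_union, add_comm, consSum]
  · refine congrArg₂ _ ?_ (sum_congr rfl fun B hB => ?_)
    · rw [sum_image, powersetCard_one, sum_map]
      · refine sum_congr rfl fun c hc => ?_
        have hic : i ≠ c := (h c hc).ne
        have e1 : insert i C \ {i, c} = C.erase c := by ext; simp; grind
        have e2 : shuffleSign d {i, c} (C.erase c) = shuffleSign d {c} (C.erase c) := by
          rw [insert_eq, shuffleSign_union_left (by simpa using hic), shuffleSign_eq_one, one_mul]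
          simpa using fun j _ hj => (h j hj).le
        change shuffleSign d {i, c} (insert i C \ {i, c}) • _ = _
        rw [Function.Embedding.coeFn_mk, e1, e2, selfBracket_pair hx hic, map_zsmul, smul_smul,
          shuffleSign_singleton, if_neg (h c hc).not_gt, mul_one]
      · intro A hA B hB hAB
        have hA' : i ∉ A := fun hiA => hi ((mem_powersetCard.1 hA).1 hiA)
        have hB' : i ∉ B := fun hiB => hi ((mem_powersetCard.1 hB).1 hiB)
        rw [← erase_insert hA', ← erase_insert hB']
        exact congrArg (fun s => s.erase i) hAB
    · obtain ⟨hB, -⟩ := mem_powersetCard.1 hB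
      have hiB : i ∉ B := fun hiB => hi (hB hiB)
      have e1 : insert i C \ B = insert i (C \ B) := insert_sdiff_of_notMem _ hiB
      rw [e1, mulSet_insert_min x fun j hj => h j (mem_sdiff.1 hj).1, insert_eq,
        shuffleSign_union_right (by simp [hi]),
        shuffleSign_swap (A := {i}) (B := B) (by simpa using hiB), totalDeg_singleton,
        shuffleSign_eq_one (A := {i}), mul_one]
      simpa using fun j hj => (h j (hB hj)).le
  · rw [disjoint_left]
    intro B hB hB'
    obtain ⟨A, -, rfl⟩ := mem_image.1 hB'
    exact hi ((mem_powersetCard.1 hB).1 (mem_insert_self _ _))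

/-- The vanishing behind `ι_K l = 0`, for a family of degree one killed by `bracketOp` and
`quadOp`. -/
theorem sum_consSum_eq_zero {d : ι → ℤ} {x : ι → V} (hx : ∀ i, x i ∈ 𝒜 (-d i))
    {Y : Finset ι → V} (hY : HasDeg 𝒜 d 1 Y) (hD : G.bracketOp d x 1 Y = 0)
    (hQ : G.quadOp d x 1 Y = 0) (S : Finset ι) :
    ∑ A ∈ S.powerset, shuffleSign d A (S \ A) •
      G.consSum (totalDeg d A + 1) (Y A) d x (S \ A) = 0 := by
  simp only [consSum, smul_add, sum_add_distrib]
  have key1 : ∑ E ∈ S.powerset, (2 * shuffleSign d (S \ E) E) •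
      G.mulSet x E (G.bracketOp d x 1 Y (S \ E)) = 0 := by simp [hD]
  have key2 : ∑ E ∈ S.powerset, shuffleSign d (S \ E) E •
      G.mulSet x E (G.quadOp d x 1 Y (S \ E)) = 0 := by simp [hQ]
  rw [← add_zero (0 : V)]
  refine congrArg₂ _ (Eq.trans ?_ key1) (Eq.trans ?_ key2)
  · simp only [bracketOp_apply, map_sum, smul_sum, map_zsmul, smul_smul]
    rw [sum_sigma', sum_sigma']
    refine sum_bij' (fun a _ => ⟨S \ insert a.2 a.1, a.2⟩) (fun a _ => ⟨S \ insert a.2 a.1, a.2⟩)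
      ?_ ?_ ?_ ?_ ?_
    · rintro ⟨A, c⟩ h
      simp only [mem_sigma, mem_powerset, mem_sdiff] at h ⊢
      simp [h]
    · rintro ⟨A, c⟩ h
      simp only [mem_sigma, mem_powerset, mem_sdiff] at h ⊢
      simp [h]
    · rintro ⟨A, c⟩ h
      simp only [mem_sigma, mem_powerset, mem_sdiff] at h
      have : S \ insert c (S \ insert c A) = A := by ext; simp; grind
      simp [this]
    · rintro ⟨A, c⟩ h
      simp only [mem_sigma, mem_powerset, mem_sdiff] at h
      have : S \ insert c (S \ insert c A) = A := by ext; simp; grind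
      simp [this]
    · rintro ⟨A, c⟩ h
      simp only [mem_sigma, mem_powerset, mem_sdiff] at h ⊢
      obtain ⟨hA, hc, hcA⟩ := h
      have e1 : (S \ A).erase c = S \ insert c A := by ext; simp; grind
      have e2 : S \ (S \ insert c A) = insert c A :=
        Finset.sdiff_sdiff_eq_self (insert_subset hc hA)
      have hd : Disjoint {c} A := by simpa using hcA
      rw [shuffleSign_erase_right (S := S \ A) (i := c) (by simp [hc, hcA]), e1, e2,
        erase_insert hcA, insert_eq, shuffleSign_union_left hd, shuffleSign_union_left hd,
        shuffleSign_singleton_self, add_comm 1]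
      congr 1
      ring
  · simp only [quadOp_apply, map_sum, smul_sum, map_zsmul, smul_smul]
    have h2 : ∀ A ∈ S.powerset, ∑ B ∈ powersetCard 2 (S \ A), (shuffleSign d A (S \ A) *
        (paritySign ((totalDeg d A + 1) * totalDeg d B) * shuffleSign d B ((S \ A) \ B))) •
          G.mulSet x ((S \ A) \ B) (G.wedge (G.selfBracket d x B) (Y A)) =
        ∑ B ∈ (S \ A).powerset, (shuffleSign d A (S \ A) *
        (paritySign ((totalDeg d A + 1) * totalDeg d B) * shuffleSign d B ((S \ A) \ B))) •
          G.mulSet x ((S \ A) \ B) (G.wedge (G.selfBracket d x B) (Y A)) := by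
      intro A _
      refine sum_subset (fun B hB => mem_powerset.2 (mem_powersetCard.1 hB).1) fun B hB hB' => ?_
      rw [selfBracket_eq_zero fun h => hB' (mem_powersetCard.2 ⟨mem_powerset.1 hB, h⟩), map_zero,
        LinearMap.zero_apply, map_zero, smul_zero]
    rw [sum_congr rfl h2, sum_sigma', sum_sigma']
    refine sum_bij' (fun a _ => ⟨S \ (a.2 ∪ a.1), a.2⟩) (fun a _ => ⟨S \ (a.2 ∪ a.1), a.2⟩)
      ?_ ?_ ?_ ?_ ?_
    · rintro ⟨A, B⟩ h
      simp only [mem_sigma, mem_powerset] at h ⊢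
      grind
    · rintro ⟨A, B⟩ h
      simp only [mem_sigma, mem_powerset] at h ⊢
      grind
    · rintro ⟨A, B⟩ h
      simp only [mem_sigma, mem_powerset, subset_sdiff] at h
      have : S \ (B ∪ (S \ (B ∪ A))) = A := by
        ext a; simp; grind [Finset.disjoint_left]
      simp [this]
    · rintro ⟨A, B⟩ h
      simp only [mem_sigma, mem_powerset, subset_sdiff] at h
      have : S \ (B ∪ (S \ (B ∪ A))) = A := by
        ext a; simp; grind [Finset.disjoint_left]
      simp [this]
    · rintro ⟨A, B⟩ h
      simp only [mem_sigma, mem_powerset, subset_sdiff] at h ⊢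
      obtain ⟨hA, hB, hBA⟩ := h
      have e1 : (S \ A) \ B = S \ (B ∪ A) := by ext; simp; tauto
      have e2 : S \ (S \ (B ∪ A)) = B ∪ A := Finset.sdiff_sdiff_eq_self (union_subset hB hA)
      have e3 : (B ∪ A) \ B = A := by
        rw [union_sdiff_left, sdiff_eq_self_of_disjoint hBA.symm]
      rw [shuffleSign_sdiff_right (B := S \ A) (C := B) (subset_sdiff.2 ⟨hB, hBA⟩), e1, e2, e3,
        shuffleSign_union_left hBA, G.wedge_comm' (hasDeg_selfBracket hx B) (hY A), map_zsmul,
        smul_smul]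
      congr 1
      have hs : paritySign ((totalDeg d A + 1) * totalDeg d B) *
          paritySign (-(totalDeg d B + 1) * -(totalDeg d A + 1)) =
          paritySign (1 + totalDeg d A) := by
        simp only [paritySign_eq_ite, Int.even_mul, even_neg, Int.even_add]
        by_cases hi : Even (totalDeg d A) <;> by_cases hj : Even (totalDeg d B) <;> simp [hi, hj]
      linear_combination (shuffleSign d A (S \ (B ∪ A)) * shuffleSign d A B *
        shuffleSign d B (S \ (B ∪ A))) * hs

end Gerstenhaber

end Expansion

section Forms

variable {V : Type*} [AddCommGroup V] [Module ℝ V] {𝒜 : ℤ → Submodule ℝ V}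

namespace Gerstenhaber

variable {G : Gerstenhaber 𝒜}

theorem coe_prj {𝒢 : ℤ → Submodule ℝ V} [DirectSum.Decomposition 𝒢] {i : ℤ} {v : V}
    (hv : v ∈ 𝒢 i) : (prj 𝒢 i v : V) = v :=
  DirectSum.decompose_of_mem_same 𝒢 hv

theorem coe_cons {𝒢 : ℤ → Submodule ℝ V} {l : ℕ} {D : ℤ} {d : Fin l → ℤ} (y : 𝒢 D)
    (x : (i : Fin l) → 𝒢 (d i)) :
    (fun i : Fin (l + 1) => ((Fin.cons y x : (i : Fin (l + 1)) →
      𝒢 ((Fin.cons D d : Fin (l + 1) → ℤ) i)) i : V)) = Fin.cons (y : V) fun j => (x j : V) := by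
  funext i
  refine Fin.cases rfl (fun i => rfl) i

theorem bracketSum_cons {l : ℕ} {D : ℤ} {d : Fin l → ℤ} {y : V} {x : Fin l → V}
    (hy : y ∈ 𝒜 (-D)) (hx : ∀ i, x i ∈ 𝒜 (-d i)) :
    G.bracketSum (Fin.cons D d : Fin (l + 1) → ℤ) (Fin.cons y x : Fin (l + 1) → V) univ =
      G.consSum D y d x univ := by
  rw [univ_fin_succ, bracketSum_insert_min (Fin.cases hy hx) (by simp [Fin.pos_iff_ne_zero]),
    consSum_map]
  rfl

theorem castForm_insertPos_mathcalN [DirectSum.Decomposition (negG 𝒜)] {k n : ℕ}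
    (h : 2 + (k + 1) = n) (d : Fin n → ℤ) (x : (i : Fin n) → negG 𝒜 (d i)) :
    (2 : ℝ) • castForm h (insertPos (negG 𝒜) 1 (l2G G (negG 𝒜))
      (mathcalN G (negG 𝒜) (k + 2))) d x = G.bracketSum d (fun i => (x i : V)) univ := by
  subst h
  change (2 : ℝ) • ∑ σ ∈ unshuffles 2 (2 + (k + 1)), _ = _
  rw [smul_sum]
  refine sum_unshuffles _ _ fun σ e₁ e₂ h₁ h₂ h => ?_
  have hl : ∀ (d' : Fin 2 → ℤ) (x' : (i : Fin 2) → negG 𝒜 (d' i)),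
      l2G G (negG 𝒜) d' x' ∈ negG 𝒜 ((∑ i, d' i) + 1) := fun d' x' =>
    zsmul_mem (mem_of_eq (G.bracket_mem _ _ _ _ (x' 0).2 (x' 1).2)
      (by rw [Fin.sum_univ_two]; ring)) _
  have he : e₁ 0 ≠ e₁ 1 := by simp
  have hlt : ¬ e₁ 1 < e₁ 0 := by simp
  have hu : univ.map e₁.toEmbedding = {e₁ 0, e₁ 1} := by
    ext i; simp [Fin.exists_fin_two, eq_comm]
  have x₁ : ∀ i, (x (σ (Fin.castAdd (k + 1) i)) : V) = x (e₁ i) := fun i => by rw [h₁]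
  have x₂ : ∀ j, (x (σ (Fin.natAdd 2 j)) : V) = x (e₂ j) := fun j => by rw [h₂]
  rw [koszulSign_eq_shuffleSign d σ e₁ e₂ h₁ h₂, ← compl_eq_univ_sdiff, h]
  simp only [mathcalN]
  rw [coe_cons, wedgeAll_cons, coe_prj (hl _ _), mulSet_map, hu,
    selfBracket_pair (d := d) (fun i => (x i).2) he, shuffleSign_singleton, if_neg hlt,
    smul_comm]
  simp only [l2G, x₁, x₂, h₁, mul_one]
  rw [← paritySign, mul_smul, map_zsmul _ (2 : ℤ), two_smul, two_smul]

theorem lFormsG_eq [DirectSum.Decomposition (negG 𝒜)] (k : ℕ) (d : Fin (k + 2) → ℤ)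
    (x : (i : Fin (k + 2)) → negG 𝒜 (d i)) :
    lFormsG G (negG 𝒜) (k + 2) d x =
      (2 : ℝ)⁻¹ • G.bracketSum d (fun i => (x i : V)) univ := by
  rw [eq_inv_smul_iff₀ two_ne_zero]
  cases k with
  | zero =>
    have h0 : (univ : Finset (Fin 2)) = {0, 1} := rfl
    have h1 : powersetCard 2 (univ : Finset (Fin 2)) = {univ} := powersetCard_self _
    rw [bracketSum, h1, sum_singleton, sdiff_self, bot_eq_empty, shuffleSign_empty_right,
      mulSet_empty, one_smul, h0,
      selfBracket_pair (d := d) (fun i => (x i).2) (by decide), shuffleSign_singleton,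
      if_neg (by decide), mul_one, mul_smul, two_smul, two_smul]
    rfl
  | succ k => exact castForm_insertPos_mathcalN _ d x

theorem lFormsG_mem [DirectSum.Decomposition (negG 𝒜)] (k : ℕ) (d : Fin (k + 2) → ℤ)
    (x : (i : Fin (k + 2)) → negG 𝒜 (d i)) :
    lFormsG G (negG 𝒜) (k + 2) d x ∈ negG 𝒜 ((∑ i, d i) + 1) := by
  have hx : ∀ i, (x i : V) ∈ 𝒜 (-d i) := fun i => (x i).2
  rw [lFormsG_eq]
  refine Submodule.smul_mem _ _ ?_
  have h := hasDeg_wedgeOp_iterate (G := G) hx (hasDeg_selfBracket (G := G) hx) k univ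
  rw [wedgeOp_iterate_selfBracket hx (by simp), ← Nat.cast_smul_eq_nsmul ℝ,
    Submodule.smul_mem_iff _ (by positivity)] at h
  exact h

theorem lFormsG_cons [DirectSum.Decomposition (negG 𝒜)] {l : ℕ} {D : ℤ} {d : Fin (l + 1) → ℤ}
    (y : negG 𝒜 D) (x : (i : Fin (l + 1)) → negG 𝒜 (d i)) :
    lFormsG G (negG 𝒜) (l + 2) (Fin.cons D d) (Fin.cons y x) =
      (2 : ℝ)⁻¹ • G.consSum D y d (fun i => (x i : V)) univ := by
  rw [lFormsG_eq, coe_cons, bracketSum_cons y.2 fun i => (x i).2]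

theorem insertPos_zero_lFormsG [DirectSum.Decomposition (negG 𝒜)] (k l : ℕ) (δ : ℤ) :
    insertPos (negG 𝒜) δ (0 : GForm (negG 𝒜) k) (lFormsG G (negG 𝒜) (l + 1)) = 0 := by
  funext d x
  refine sum_eq_zero fun σ _ => ?_
  cases l with
  | zero => exact smul_zero _
  | succ l => simp [lFormsG_cons, prj, consSum]

theorem insertPos_lFormsG_lFormsG [DirectSum.Decomposition (negG 𝒜)] (k l : ℕ) :
    insertPos (negG 𝒜) 1 (lFormsG G (negG 𝒜) k) (lFormsG G (negG 𝒜) (l + 1)) = 0 := by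
  obtain _ | _ | k := k
  · exact insertPos_zero_lFormsG 0 l 1
  · exact insertPos_zero_lFormsG 1 l 1
  obtain _ | l := l
  · funext d x
    exact sum_eq_zero fun σ _ => smul_zero _
  funext d x
  have hx : ∀ i, (x i : V) ∈ 𝒜 (-d i) := fun i => (x i).2
  let X := fun i => (x i : V)
  let Y : Finset (Fin (k + 2 + (l + 1))) → V :=
    ((2 : ℝ)⁻¹ * (k.factorial : ℝ)⁻¹) • (G.wedgeOp d X ^ k) (G.selfBracket d X)
  have hY : HasDeg 𝒜 d 1 Y := fun S =>
    Submodule.smul_mem _ _ (hasDeg_wedgeOp_iterate hx (hasDeg_selfBracket hx) k S)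
  have hD : G.bracketOp d X 1 Y = 0 := by
    rw [map_smul, bracketOp_wedgeOp_iterate hx, smul_zero]
  have hQ : G.quadOp d X 1 Y = 0 := by
    rw [map_smul, quadOp_wedgeOp_iterate hx, smul_zero]
  have hYA (A) : Y A = ((2 : ℝ)⁻¹ * (k.factorial : ℝ)⁻¹) •
      (G.wedgeOp d X ^ k) (G.selfBracket d X) A := rfl
  have hY0 : ∀ A : Finset (Fin (k + 2 + (l + 1))), A.card ≠ k + 2 → Y A = 0 := fun A hA => by
    rw [hYA, wedgeOp_iterate_selfBracket_eq_zero hx hA, smul_zero]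
  have hY1 : ∀ A : Finset (Fin (k + 2 + (l + 1))), A.card = k + 2 →
      Y A = (2 : ℝ)⁻¹ • G.bracketSum d X A := fun A hA => by
    rw [hYA, wedgeOp_iterate_selfBracket hx hA, ← Nat.cast_smul_eq_nsmul ℝ, smul_smul,
      mul_assoc, inv_mul_cancel₀ (by positivity), mul_one]
  have hsum := sum_consSum_eq_zero hx hY hD hQ univ
  rw [← sum_subset (s₁ := powersetCard (k + 2) univ)
    (fun A hA => mem_powerset.2 (mem_powersetCard.1 hA).1)] at hsum
  · have h2 : (2 : ℝ) • insertPos (negG 𝒜) 1 (lFormsG G (negG 𝒜) (k + 2))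
        (lFormsG G (negG 𝒜) (l + 2)) d x = 0 := by
      rw [← hsum]
      change (2 : ℝ) • ∑ σ ∈ unshuffles (k + 2) (k + 2 + (l + 1)), _ = _
      rw [smul_sum]
      refine sum_unshuffles _ _ fun σ e₁ e₂ h₁ h₂ h => ?_
      have x₁ : ∀ i, (x (σ (Fin.castAdd (l + 1) i)) : V) = x (e₁ i) := fun i => by rw [h₁]
      have x₂ : ∀ j, (x (σ (Fin.natAdd (k + 2) j)) : V) = x (e₂ j) := fun j => by rw [h₂]
      rw [koszulSign_eq_shuffleSign d σ e₁ e₂ h₁ h₂, ← compl_eq_univ_sdiff, h, lFormsG_cons,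
        smul_comm, smul_inv_smul₀ two_ne_zero, coe_prj (lFormsG_mem k _ _), lFormsG_eq,
        consSum_map, hY1 _ (by simp), bracketSum_map, totalDeg_map]
      simp only [x₁, x₂, h₁, h₂]
      rfl
    exact (smul_eq_zero.1 h2).resolve_left two_ne_zero
  · intro A _ hA
    rw [hY0 A fun h => hA (mem_powersetCard.2 ⟨subset_univ _, h⟩)]
    simp [consSum]

theorem insertionOp_singleF_lFormsG [DirectSum.Decomposition (negG 𝒜)] (m n p q : ℕ) :
    insertionOp (negG 𝒜) 1 (singleF (negG 𝒜) m (lFormsG G (negG 𝒜) m) p)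
      (singleF (negG 𝒜) n (lFormsG G (negG 𝒜) n) q) = 0 := by
  obtain _ | l := q
  · rfl
  change insertPos (negG 𝒜) 1 _ _ = 0
  by_cases hn : l + 1 = n
  · subst hn
    have h1 : singleF (negG 𝒜) (l + 1) (lFormsG G (negG 𝒜) (l + 1)) (l + 1) =
      lFormsG G (negG 𝒜) (l + 1) := by simp [singleF, castForm]
    rw [h1]
    by_cases hm : p = m
    · subst hm
      have h2 : singleF (negG 𝒜) p (lFormsG G (negG 𝒜) p) p = lFormsG G (negG 𝒜) p := by
        simp [singleF, castForm]
      rw [h2]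
      exact insertPos_lFormsG_lFormsG p l
    · rw [singleF, dif_neg hm]
      exact insertPos_zero_lFormsG p l 1
  · rw [singleF.eq_1 _ n, dif_neg hn]
    funext d x
    exact sum_eq_zero fun σ _ => smul_zero _

theorem castForm_zero {𝒢 : ℤ → Submodule ℝ V} {m n : ℕ} (h : m = n) :
    castForm h (0 : GForm 𝒢 m) = 0 := by
  subst h
  rfl

end Gerstenhaber

end Forms

/-- `[l_m, l_n]_RN = 0` for all positive integers `m, n`. -/
theorem rnBracket_lForms_lForms
    {V : Type*} [AddCommGroup V] [Module ℝ V] {𝒜 : ℤ → Submodule ℝ V}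
    (G : Gerstenhaber 𝒜) [DirectSum.Decomposition (negG 𝒜)]
    (m n : ℕ) (hm : 1 ≤ m) (hn : 1 ≤ n) :
    rnBracketM (negG 𝒜) 1 1 (singleF (negG 𝒜) m (lFormsG G (negG 𝒜) m))
        (singleF (negG 𝒜) n (lFormsG G (negG 𝒜) n)) = 0 := by
  funext k
  simp [rnBracketM, Gerstenhaber.insertionOp_singleF_lFormsG, Gerstenhaber.castForm_zero]
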